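/- Fix 0 < a1 < ... < ak. Then for all sufficiently small ε > 0 the function f_ε(x) = ∑_{m=1}^k exp(a_m x) + ∑_{m=1}^k exp(−a_m x) − ε is k-positive definite: for all pairwise distinct x1,...,xk ∈ ℝ the matrix (f_ε(xi + xj))_{1≤i,j≤k} is positive definite. -/

import Mathlib

open Matrix

/-- Rolle for a finite set of zeros. -/
theorem rolle_finset (u u' : ℝ → ℝ) (hu : ∀ t, HasDerivAt u (u' t) t) (Z : Finset ℝ) :
    (∀ z ∈ Z, u z = 0) → Z.Nonempty →
    ∃ Z' : Finset ℝ, Z'.card + 1 = Z.card ∧ ∀ z ∈ Z', u' z = 0 ∧ (∃ y ∈ Z, y < z) ∧ (∃ y ∈ Z, z < y) := by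
  induction Z using Finset.induction_on_max with
  | empty => intro _ h; simp at h
  | insert m Z hm ih =>
    intro hz _
    have hmZ : m ∉ Z := fun h => lt_irrefl _ (hm m h)
    rcases Z.eq_empty_or_nonempty with rfl | hne
    · exact ⟨∅, by simp, by simp⟩
    · obtain ⟨Z', hc, hZ'⟩ := ih (fun z h => hz z (Finset.mem_insert_of_mem h)) hne
      have hmax := Finset.max'_mem Z hne
      obtain ⟨c, hc1, hc2⟩ := exists_hasDerivAt_eq_zero (f := u) (f' := u') (hm _ hmax)
        (fun t _ => (hu t).continuousAt.continuousWithinAt)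
        (by rw [hz _ (Finset.mem_insert_of_mem hmax), hz m (Finset.mem_insert_self _ _)])
        (fun t _ => hu t)
      have hcZ : c ∉ Z' := by
        intro h
        obtain ⟨_, _, y, hy, hy2⟩ := hZ' c h
        have := Finset.le_max' Z y hy
        have := hc1.1
        linarith
      refine ⟨insert c Z', ?_, ?_⟩
      · rw [Finset.card_insert_of_notMem hcZ, Finset.card_insert_of_notMem hmZ, hc]
      · intro z h
        rcases Finset.mem_insert.1 h with rfl | h
        · exact ⟨hc2, ⟨_, Finset.mem_insert_of_mem hmax, hc1.1⟩, ⟨m, Finset.mem_insert_self _ _, hc1.2⟩⟩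
        · obtain ⟨h1, ⟨y, hy, hy'⟩, ⟨w, hw, hw'⟩⟩ := hZ' z h
          exact ⟨h1, ⟨y, Finset.mem_insert_of_mem hy, hy'⟩, ⟨w, Finset.mem_insert_of_mem hw, hw'⟩⟩

theorem twist_deriv (u u' : ℝ → ℝ) (hu : ∀ t, HasDerivAt u (u' t) t) (q t : ℝ) :
    HasDerivAt (fun t => Real.exp (-q * t) * u t) (Real.exp (-q * t) * (u' t - q * u t)) t := by
  have h1 : HasDerivAt (fun t => Real.exp (-q * t)) (Real.exp (-q * t) * (-q)) t := by
    simpa using ((hasDerivAt_id t).const_mul (-q)).exp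
  exact (h1.fun_mul (hu t)).congr_deriv (by ring)

theorem rolle_twist (u u' : ℝ → ℝ) (hu : ∀ t, HasDerivAt u (u' t) t) (q : ℝ) (Z : Finset ℝ)
    (hz : ∀ z ∈ Z, u z = 0) (hne : Z.Nonempty) :
    ∃ Z' : Finset ℝ, Z'.card + 1 = Z.card ∧
      ∀ z ∈ Z', u' z - q * u z = 0 ∧ (∃ y ∈ Z, y < z) ∧ (∃ y ∈ Z, z < y) := by
  obtain ⟨Z', h1, h2⟩ := rolle_finset _ _ (twist_deriv u u' hu q) Z
    (fun z h => by simp [hz z h]) hne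
  refine ⟨Z', h1, fun z h => ⟨?_, (h2 z h).2⟩⟩
  simpa [Real.exp_ne_zero] using (h2 z h).1

/-- The middle Rolle point, positive `u 0`. -/
theorem middle_pos (u u' : ℝ → ℝ) (hu : ∀ t, HasDerivAt u (u' t) t) (cu' : Continuous u')
    (α β A B : ℝ) (hα : α < 0) (hβ : 0 ≤ β) (hAB : A < B) (h1 : u α = 0) (h2 : u β = 0)
    (h0 : 0 < u 0) :
    (∃ z, α < z ∧ z < β ∧ 0 ≤ z ∧ u' z - A * u z = 0) ∨
    (∃ z, α < z ∧ z < β ∧ z < 0 ∧ u' z - B * u z = 0) := by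
  have hβ' : 0 < β := by
    rcases hβ.eq_or_lt with h | h
    · rw [← h] at h2; linarith
    · exact h
  have cu : Continuous u := continuous_iff_continuousAt.2 fun t => (hu t).continuousAt
  by_cases hc : 0 ≤ u' 0 - A * u 0
  · left
    obtain ⟨c, hc1, hc2⟩ := exists_hasDerivAt_eq_slope _ _ hβ'
      (by fun_prop) (fun t _ => twist_deriv u u' hu A t)
    have hneg : u' c - A * u c < 0 := by
      have : Real.exp (-A * c) * (u' c - A * u c) < 0 := by
        rw [hc2, h2]
        apply div_neg_of_neg_of_pos
        · simp [h0]
        · linarith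
      by_contra hcon
      push Not at hcon
      have := mul_nonneg (Real.exp_pos (-A * c)).le hcon
      linarith
    have := intermediate_value_Icc' hc1.1.le (f := fun t => u' t - A * u t) (by fun_prop)
    obtain ⟨z, hz, hz'⟩ := this (show (0:ℝ) ∈ _ from ⟨hneg.le, hc⟩)
    exact ⟨z, by linarith [hz.1], by linarith [hz.2, hc1.2], hz.1, hz'⟩
  · right
    push Not at hc
    obtain ⟨c, hc1, hc2⟩ := exists_hasDerivAt_eq_slope _ _ hα
      (by fun_prop) (fun t _ => twist_deriv u u' hu B t)
    have hpos : 0 < u' c - B * u c := by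
      have : 0 < Real.exp (-B * c) * (u' c - B * u c) := by
        rw [hc2, h1]
        apply div_pos
        · simp [h0]
        · linarith
      exact pos_of_mul_pos_right this (Real.exp_pos _).le
    have hB : u' 0 - B * u 0 < 0 := by nlinarith
    have := intermediate_value_Icc' hc1.2.le (f := fun t => u' t - B * u t) (by fun_prop)
    obtain ⟨z, hz, hz'⟩ := this (show (0:ℝ) ∈ _ from ⟨hB.le, hpos.le⟩)
    have hz0 : z < 0 := by
      refine lt_of_le_of_ne hz.2 ?_
      rintro rfl
      simp only at hz'
      linarith
    exact ⟨z, by linarith [hz.1, hc1.1], by linarith, hz0, hz'⟩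

theorem middle (u u' : ℝ → ℝ) (hu : ∀ t, HasDerivAt u (u' t) t) (cu' : Continuous u')
    (α β A B : ℝ) (hα : α < 0) (hβ : 0 ≤ β) (hAB : A < B) (h1 : u α = 0) (h2 : u β = 0) :
    (∃ z, α < z ∧ z < β ∧ 0 ≤ z ∧ u' z - A * u z = 0) ∨
    (∃ z, α < z ∧ z < β ∧ z < 0 ∧ u' z - B * u z = 0) := by
  rcases lt_trichotomy (u 0) 0 with h | h | h
  · have := middle_pos (fun t => - u t) (fun t => - u' t) (fun t => (hu t).neg) cu'.neg α β A B
      hα hβ hAB (by simp [h1]) (by simp [h2]) (by simp [h])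
    refine this.imp ?_ ?_
    · rintro ⟨z, a1, a2, a3, a4⟩
      exact ⟨z, a1, a2, a3, by linarith⟩
    · rintro ⟨z, a1, a2, a3, a4⟩
      exact ⟨z, a1, a2, a3, by linarith⟩
  · right
    have cu : Continuous u := continuous_iff_continuousAt.2 fun t => (hu t).continuousAt
    obtain ⟨c, hc1, hc2⟩ := exists_hasDerivAt_eq_zero hα (f := fun t => Real.exp (-B * t) * u t)
      (by fun_prop) (by simp [h1, h]) (fun t _ => twist_deriv u u' hu B t)
    exact ⟨c, hc1.1, by linarith [hc1.2], hc1.2, by simpa [Real.exp_ne_zero] using hc2⟩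
  · exact middle_pos u u' hu cu' α β A B hα hβ hAB h1 h2 h

theorem finish (E : Finset ℝ) (q C : ℝ) (hC : 0 ≤ C) :
    ∃ C' : ℝ, 0 ≤ C' ∧ ∀ (b : ℝ → ℝ) (x : ℝ), (∑ p ∈ E, b p * Real.exp (p * x) = 0) →
      (∀ p ∈ E, p * x ≤ q * x) → (∀ p ∈ E.erase q, |b p * (p - q)| ≤ C * |b 0 * (0 - q)|) →
      ∀ p ∈ E, |b p| ≤ C' * |b 0| := by
  set D : ℝ → ℝ := fun p => C * |q| / |p - q| with hD
  have hD0 : ∀ p, 0 ≤ D p := fun p => by positivity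
  refine ⟨∑ p ∈ E.erase q, D p, Finset.sum_nonneg fun p _ => hD0 p, ?_⟩
  intro b x hx hle hb
  have hb' : ∀ p ∈ E.erase q, |b p| ≤ D p * |b 0| := by
    intro p hp
    have hne : 0 < |p - q| := abs_pos.2 (sub_ne_zero.2 (Finset.ne_of_mem_erase hp))
    have := hb p hp
    rw [abs_mul, abs_mul, zero_sub, abs_neg] at this
    rw [hD]
    simp only
    rw [div_mul_eq_mul_div, le_div_iff₀ hne]
    linarith
  intro p hp
  by_cases hpq : p = q
  · subst hpq
    rw [← Finset.add_sum_erase E _ hp] at hx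
    have h1 : b p * Real.exp (p * x) = - ∑ r ∈ E.erase p, b r * Real.exp (r * x) := by linarith
    have h2 : |b p| * Real.exp (p * x) ≤ (∑ r ∈ E.erase p, D r) * |b 0| * Real.exp (p * x) := by
      calc |b p| * Real.exp (p * x) = |b p * Real.exp (p * x)| := by
            rw [abs_mul, abs_of_pos (Real.exp_pos _)]
        _ = |∑ r ∈ E.erase p, b r * Real.exp (r * x)| := by rw [h1, abs_neg]
        _ ≤ ∑ r ∈ E.erase p, |b r * Real.exp (r * x)| := Finset.abs_sum_le_sum_abs _ _
        _ ≤ ∑ r ∈ E.erase p, D r * |b 0| * Real.exp (p * x) := by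
            refine Finset.sum_le_sum fun r hr => ?_
            rw [abs_mul, abs_of_pos (Real.exp_pos _)]
            have := hb' r hr
            have := Real.exp_le_exp.2 (hle r (Finset.mem_of_mem_erase hr))
            have := hD0 r
            gcongr
        _ = _ := by rw [Finset.sum_mul, Finset.sum_mul]
    exact le_of_mul_le_mul_right h2 (Real.exp_pos _)
  · have hpe : p ∈ E.erase q := Finset.mem_erase.2 ⟨hpq, hp⟩
    refine (hb' p hpe).trans ?_
    gcongr
    exact Finset.single_le_sum (f := D) (fun r _ => hD0 r) hpe

theorem expsum_deriv (E : Finset ℝ) (b : ℝ → ℝ) (t : ℝ) :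
    HasDerivAt (fun t => ∑ p ∈ E, b p * Real.exp (p * t)) (∑ p ∈ E, b p * (p * Real.exp (p * t))) t := by
  refine HasDerivAt.fun_sum fun p _ => ?_
  have : HasDerivAt (fun t => Real.exp (p * t)) (Real.exp (p * t) * p) t := by
    simpa using ((hasDerivAt_id t).const_mul p).exp
  exact (this.const_mul (b p)).congr_deriv (by ring)

theorem expsum_twist (E : Finset ℝ) (b : ℝ → ℝ) (q t : ℝ) 
    (h : (∑ p ∈ E, b p * (p * Real.exp (p * t))) - q * (∑ p ∈ E, b p * Real.exp (p * t)) = 0) :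
    ∑ p ∈ E.erase q, b p * (p - q) * Real.exp (p * t) = 0 := by
  rw [← h, Finset.mul_sum, ← Finset.sum_sub_distrib]
  rw [Finset.sum_erase _ (by simp)]
  exact Finset.sum_congr rfl fun p _ => by ring

/-- Main bound: coefficients of an exponential sum are controlled by the constant one. -/
theorem coeff_bound (n : ℕ) : ∀ E : Finset ℝ, (0:ℝ) ∈ E → E.card = n + 1 →
    ∃ C : ℝ, 0 ≤ C ∧ ∀ (b : ℝ → ℝ) (X Y : Finset ℝ), (∀ x ∈ X, x < 0) → (∀ y ∈ Y, 0 ≤ y) →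
      X.card = (E.filter (· < 0)).card → Y.card = (E.filter (0 < ·)).card →
      (∀ x ∈ X, ∑ p ∈ E, b p * Real.exp (p * x) = 0) →
      (∀ x ∈ Y, ∑ p ∈ E, b p * Real.exp (p * x) = 0) →
      ∀ p ∈ E, |b p| ≤ C * |b 0| := by
  induction n with
  | zero =>
    intro E h0 hE
    refine ⟨1, zero_le_one, ?_⟩
    intro b X Y _ _ _ _ _ _ p hp
    obtain ⟨e, rfl⟩ := Finset.card_eq_one.1 hE
    simp only [Finset.mem_singleton] at h0 hp
    rw [hp, ← h0]; simp
  | succ n ih =>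
    intro E h0 hE
    -- removing a nonzero exponent
    have key : ∀ q ∈ E, q ≠ 0 → ∃ C : ℝ, 0 ≤ C ∧ ∀ (b : ℝ → ℝ) (X Y : Finset ℝ) (x : ℝ),
        (∑ p ∈ E, b p * Real.exp (p * x) = 0) → (∀ p ∈ E, p * x ≤ q * x) →
        (∀ x ∈ X, x < 0) → (∀ y ∈ Y, 0 ≤ y) →
        X.card = ((E.erase q).filter (· < 0)).card → Y.card = ((E.erase q).filter (0 < ·)).card →
        (∀ t ∈ X, (∑ p ∈ E, b p * (p * Real.exp (p * t))) - q * (∑ p ∈ E, b p * Real.exp (p * t)) = 0) →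
        (∀ t ∈ Y, (∑ p ∈ E, b p * (p * Real.exp (p * t))) - q * (∑ p ∈ E, b p * Real.exp (p * t)) = 0) →
        ∀ p ∈ E, |b p| ≤ C * |b 0| := by
      intro q hq hq0
      obtain ⟨C, hC, h⟩ := ih (E.erase q) (Finset.mem_erase.2 ⟨hq0.symm, h0⟩)
        (by rw [Finset.card_erase_of_mem hq, hE]; rfl)
      obtain ⟨C', hC', h'⟩ := finish E q C hC
      refine ⟨C', hC', ?_⟩
      intro b X Y x hx hle hX hY hcX hcY hzX hzY
      refine h' b x hx hle ?_
      exact h (fun p => b p * (p - q)) X Y hX hY hcX hcY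
        (fun t ht => expsum_twist E b q t (hzX t ht)) (fun t ht => expsum_twist E b q t (hzY t ht))
    have cN : ∀ q ∈ E, q < 0 → ((E.erase q).filter (· < 0)).card + 1 = (E.filter (· < 0)).card ∧
        ((E.erase q).filter (0 < ·)).card = (E.filter (0 < ·)).card := by
      intro q hq hq0
      rw [Finset.filter_erase, Finset.filter_erase]
      constructor
      · exact Finset.card_erase_add_one (by simp [hq, hq0])
      · rw [Finset.erase_eq_of_notMem]
        simp [hq0.le]
    have cP : ∀ q ∈ E, 0 < q → ((E.erase q).filter (0 < ·)).card + 1 = (E.filter (0 < ·)).card ∧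
        ((E.erase q).filter (· < 0)).card = (E.filter (· < 0)).card := by
      intro q hq hq0
      rw [Finset.filter_erase, Finset.filter_erase]
      constructor
      · exact Finset.card_erase_add_one (by simp [hq, hq0])
      · rw [Finset.erase_eq_of_notMem]
        simp [hq0.le]
    have hEne : E.Nonempty := ⟨0, h0⟩
    set A := E.min' hEne with hA
    set B := E.max' hEne with hB
    have hAE : A ∈ E := Finset.min'_mem _ _
    have hBE : B ∈ E := Finset.max'_mem _ _
    have hAle : ∀ p ∈ E, A ≤ p := fun p hp => Finset.min'_le _ _ hp
    have hBle : ∀ p ∈ E, p ≤ B := fun p hp => Finset.le_max' _ _ hp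
    have hA0 : A ≤ 0 := hAle 0 h0
    have hB0 : 0 ≤ B := hBle 0 h0
    have cont : ∀ b : ℝ → ℝ, Continuous fun t => ∑ p ∈ E, b p * (p * Real.exp (p * t)) := by
      intro b; fun_prop
    rcases hA0.eq_or_lt with hA1 | hA1
    · -- no negative exponents
      have hN : (E.filter (· < 0)).card = 0 := by
        rw [Finset.card_eq_zero, Finset.filter_eq_empty_iff]
        intro p hp; have := hAle p hp; rw [hA1] at this; exact not_lt.2 this
      have hB1 : 0 < B := by
        rcases hB0.eq_or_lt with h | h
        · exfalso
          have : E ⊆ {0} := fun p hp => by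
            have := hAle p hp
            have := hBle p hp
            simp only [Finset.mem_singleton]; linarith
          have := Finset.card_le_card this
          simp [hE] at this
        · exact h
      obtain ⟨C, hC, h⟩ := key B hBE hB1.ne'
      refine ⟨C, hC, ?_⟩
      intro b X Y hX hY hcX hcY hzX hzY
      obtain ⟨c1, c2⟩ := cP B hBE hB1
      have hYne : Y.Nonempty := by rw [← Finset.card_pos]; omega
      obtain ⟨Y', hcY', hY'⟩ := rolle_twist _ _ (expsum_deriv E b) B Y hzY hYne
      obtain ⟨y, hy⟩ := hYne
      refine h b ∅ Y' y (hzY y hy) (fun p hp => mul_le_mul_of_nonneg_right (hBle p hp) (hY y hy))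
        (by simp) ?_ (by rw [c2, hN]; rfl) (by omega) (by simp) (fun t ht => (hY' t ht).1)
      intro z hz
      obtain ⟨_, ⟨w, hw, hw'⟩, _⟩ := hY' z hz
      exact (hY w hw).trans hw'.le
    · obtain ⟨C, hC, h⟩ := key A hAE hA1.ne
      obtain ⟨c1, c2⟩ := cN A hAE hA1
      rcases hB0.eq_or_lt with hB1 | hB1
      · -- no positive exponents
        have hP : (E.filter (0 < ·)).card = 0 := by
          rw [Finset.card_eq_zero, Finset.filter_eq_empty_iff]
          intro p hp; have := hBle p hp; rw [← hB1] at this; exact not_lt.2 this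
        refine ⟨C, hC, ?_⟩
        intro b X Y hX hY hcX hcY hzX hzY
        have hXne : X.Nonempty := by rw [← Finset.card_pos]; omega
        obtain ⟨X', hcX', hX'⟩ := rolle_twist _ _ (expsum_deriv E b) A X hzX hXne
        obtain ⟨y, hy⟩ := hXne
        refine h b X' ∅ y (hzX y hy)
          (fun p hp => mul_le_mul_of_nonpos_right (hAle p hp) (hX y hy).le)
          ?_ (by simp) (by omega) (by rw [c2, hP]; rfl) (fun t ht => (hX' t ht).1) (by simp)
        intro z hz
        obtain ⟨_, _, ⟨w, hw, hw'⟩⟩ := hX' z hz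
        exact hw'.trans (hX w hw)
      · obtain ⟨C2, hC2, h2⟩ := key B hBE hB1.ne'
        obtain ⟨d1, d2⟩ := cP B hBE hB1
        refine ⟨C + C2, by positivity, ?_⟩
        intro b X Y hX hY hcX hcY hzX hzY
        have hXne : X.Nonempty := by rw [← Finset.card_pos]; omega
        have hYne : Y.Nonempty := by rw [← Finset.card_pos]; omega
        have hα := Finset.max'_mem X hXne
        have hβ := Finset.min'_mem Y hYne
        rcases middle _ _ (expsum_deriv E b) (cont b) _ _ A B (hX _ hα) (hY _ hβ) (by linarith)
          (hzX _ hα) (hzY _ hβ) with ⟨z, z1, z2, z3, z4⟩ | ⟨z, z1, z2, z3, z4⟩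
        · obtain ⟨X', hcX', hX'⟩ := rolle_twist _ _ (expsum_deriv E b) A X hzX hXne
          obtain ⟨Y', hcY', hY'⟩ := rolle_twist _ _ (expsum_deriv E b) A Y hzY hYne
          have hzY' : z ∉ Y' := by
            intro hz
            obtain ⟨_, ⟨w, hw, hw'⟩, _⟩ := hY' z hz
            have := Finset.min'_le Y w hw
            linarith
          intro p hp
          have := h b X' (insert z Y') _ (hzX _ hα)
            (fun p hp => mul_le_mul_of_nonpos_right (hAle p hp) (hX _ hα).le) ?_ ?_ (by omega)
            (by rw [Finset.card_insert_of_notMem hzY']; omega)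
            (fun t ht => (hX' t ht).1) ?_ p hp
          · nlinarith [abs_nonneg (b 0)]
          · intro z hz
            obtain ⟨_, _, ⟨w, hw, hw'⟩⟩ := hX' z hz
            exact hw'.trans (hX w hw)
          · intro t ht
            rcases Finset.mem_insert.1 ht with rfl | ht
            · exact z3
            · obtain ⟨_, ⟨w, hw, hw'⟩, _⟩ := hY' t ht
              exact (hY w hw).trans hw'.le
          · intro t ht
            rcases Finset.mem_insert.1 ht with rfl | ht
            · exact z4
            · exact (hY' t ht).1
        · obtain ⟨X', hcX', hX'⟩ := rolle_twist _ _ (expsum_deriv E b) B X hzX hXne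
          obtain ⟨Y', hcY', hY'⟩ := rolle_twist _ _ (expsum_deriv E b) B Y hzY hYne
          have hzX' : z ∉ X' := by
            intro hz
            obtain ⟨_, _, ⟨w, hw, hw'⟩⟩ := hX' z hz
            have := Finset.le_max' X w hw
            linarith
          intro p hp
          have := h2 b (insert z X') Y' _ (hzY _ hβ)
            (fun p hp => mul_le_mul_of_nonneg_right (hBle p hp) (hY _ hβ)) ?_ ?_
            (by rw [Finset.card_insert_of_notMem hzX']; omega) (by omega)
            ?_ (fun t ht => (hY' t ht).1) p hp
          · nlinarith [abs_nonneg (b 0)]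
          · intro t ht
            rcases Finset.mem_insert.1 ht with rfl | ht
            · exact z3
            · obtain ⟨_, _, ⟨w, hw, hw'⟩⟩ := hX' t ht
              exact hw'.trans (hX w hw)
          · intro z hz
            obtain ⟨_, ⟨w, hw, hw'⟩, _⟩ := hY' z hz
            exact (hY w hw).trans hw'.le
          · intro t ht
            rcases Finset.mem_insert.1 ht with rfl | ht
            · exact z4
            · exact (hX' t ht).1

/-- Indexed version of the bound. -/
theorem coeff_bound_fin (k : ℕ) (a : Fin k → ℝ)
    (hpos : ∀ m, 0 < a m) (hmono : StrictMono a) (T : Finset (Fin k)) :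
    ∃ C : ℝ, 0 ≤ C ∧ ∀ x : Fin k → ℝ, Function.Injective x → (∀ i, i ∈ T ↔ x i < 0) →
      ∀ (b0 : ℝ) (v : Fin k → ℝ),
        (∀ j, b0 + ∑ i, v i * Real.exp ((if i ∈ T then -a i else a i) * x j) = 0) →
        ∀ i, |v i| ≤ C * |b0| := by
  set P : Fin k → ℝ := fun i => if i ∈ T then -a i else a i with hP
  have hPneg : ∀ i, P i < 0 ↔ i ∈ T := by
    intro i
    by_cases h : i ∈ T
    · simp [hP, h, hpos]
    · simp [hP, h, (hpos i).le]
  have hPpos : ∀ i, 0 < P i ↔ i ∉ T := by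
    intro i
    by_cases h : i ∈ T
    · simp [hP, h, (hpos i).le]
    · simp [hP, h, hpos i]
  have hP0 : ∀ i, P i ≠ 0 := by
    intro i h
    have h1 := hPneg i
    have h2 := hPpos i
    rw [h] at h1 h2
    simp at h1 h2
    exact h1 h2
  have habs : ∀ i, |P i| = a i := by
    intro i
    by_cases h : i ∈ T
    · simp [hP, h, abs_of_pos (hpos i)]
    · simp [hP, h, abs_of_pos (hpos i)]
  have hPinj : Function.Injective P := by
    intro i j h
    apply hmono.injective
    rw [← habs, ← habs, h]
  have h0 : (0:ℝ) ∉ Finset.univ.image P := by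
    simp [hP0]
  obtain ⟨C, hC, h⟩ := coeff_bound k (insert 0 (Finset.univ.image P)) (Finset.mem_insert_self _ _)
    (by rw [Finset.card_insert_of_notMem h0, Finset.card_image_of_injective _ hPinj]; simp)
  refine ⟨C, hC, ?_⟩
  intro x hx hT b0 v hv i
  set b : ℝ → ℝ := Function.extend P v (fun _ => b0) with hb
  have hbP : ∀ i, b (P i) = v i := fun i => hPinj.extend_apply _ _ _
  have hb0 : b 0 = b0 := Function.extend_apply' _ _ _ (by rintro ⟨i, hi⟩; exact hP0 i hi)
  have hsum : ∀ j, ∑ p ∈ insert 0 (Finset.univ.image P), b p * Real.exp (p * x j) = 0 := by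
    intro j
    rw [Finset.sum_insert h0, Finset.sum_image (fun _ _ _ _ h => hPinj h), hb0]
    refine Eq.trans ?_ (hv j)
    simp only [hbP, zero_mul, Real.exp_zero, mul_one]
    rfl
  have e1 : (insert 0 (Finset.univ.image P)).filter (· < 0) = T.image P := by
    ext p
    simp only [Finset.mem_filter, Finset.mem_insert, Finset.mem_image, Finset.mem_univ, true_and]
    constructor
    · rintro ⟨rfl | ⟨i, rfl⟩, h⟩
      · exact absurd h (lt_irrefl _)
      · exact ⟨i, (hPneg i).1 h, rfl⟩
    · rintro ⟨i, hi, rfl⟩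
      exact ⟨Or.inr ⟨i, rfl⟩, (hPneg i).2 hi⟩
  have e2 : (insert 0 (Finset.univ.image P)).filter (0 < ·) = Tᶜ.image P := by
    ext p
    simp only [Finset.mem_filter, Finset.mem_insert, Finset.mem_image, Finset.mem_univ, true_and,
      Finset.mem_compl]
    constructor
    · rintro ⟨rfl | ⟨i, rfl⟩, h⟩
      · exact absurd h (lt_irrefl _)
      · exact ⟨i, (hPpos i).1 h, rfl⟩
    · rintro ⟨i, hi, rfl⟩
      exact ⟨Or.inr ⟨i, rfl⟩, (hPpos i).2 hi⟩
  have := h b (T.image x) (Tᶜ.image x) ?_ ?_ ?_ ?_ ?_ ?_ (P i) (by simp)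
  · rwa [hbP, hb0] at this
  · intro y hy
    obtain ⟨j, hj, rfl⟩ := Finset.mem_image.1 hy
    exact (hT j).1 hj
  · intro y hy
    obtain ⟨j, hj, rfl⟩ := Finset.mem_image.1 hy
    rw [Finset.mem_compl, hT j] at hj
    exact not_lt.1 hj
  · rw [e1, Finset.card_image_of_injective _ hx, Finset.card_image_of_injective _ hPinj]
  · rw [e2, Finset.card_image_of_injective _ hx, Finset.card_image_of_injective _ hPinj]
  · intro y hy
    obtain ⟨j, hj, rfl⟩ := Finset.mem_image.1 hy
    exact hsum j
  · intro y hy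
    obtain ⟨j, hj, rfl⟩ := Finset.mem_image.1 hy
    exact hsum j

theorem quad_bound (k : ℕ) (P x : Fin k → ℝ) (C : ℝ) 
    (h : ∀ (b0 : ℝ) (v : Fin k → ℝ), (∀ j, b0 + ∑ i, v i * Real.exp (P i * x j) = 0) →
        ∀ i, |v i| ≤ C * |b0|) (c : Fin k → ℝ) (hc : c ≠ 0) :
    0 < ∑ i, (∑ j, c j * Real.exp (P i * x j)) ^ 2 ∧
    (∑ j, c j) ^ 2 ≤ k * C ^ 2 * ∑ i, (∑ j, c j * Real.exp (P i * x j)) ^ 2 := by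
  set V : Matrix (Fin k) (Fin k) ℝ := Matrix.of fun i j => Real.exp (P i * x j) with hV
  have hinj : Function.Injective V.vecMul := by
    intro v w hvw
    have hz : (v - w) ᵥ* V = 0 := by
      rw [Matrix.sub_vecMul]; exact sub_eq_zero.2 hvw
    have := h 0 (v - w) (fun j => by
      have := congrFun hz j
      simpa [hV, Matrix.vecMul, dotProduct] using this)
    ext i
    have h1 := this i
    simp only [abs_zero, mul_zero] at h1
    have h2 := abs_eq_zero.1 (le_antisymm h1 (abs_nonneg _))
    simpa [sub_eq_zero] using h2
  have hunit : IsUnit V := Matrix.vecMul_injective_iff_isUnit.1 hinj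
  have hF : ∀ i, ∑ j, c j * Real.exp (P i * x j) = (V *ᵥ c) i := by
    intro i
    simp [hV, Matrix.mulVec, dotProduct, mul_comm]
  constructor
  · have hne : V *ᵥ c ≠ 0 := by
      intro h0
      apply hc
      apply Matrix.mulVec_injective_iff_isUnit.2 hunit
      simpa using h0
    obtain ⟨i, hi⟩ := Function.ne_iff.1 hne
    refine Finset.sum_pos' (fun i _ => sq_nonneg _) ⟨i, Finset.mem_univ _, ?_⟩
    rw [hF]
    have : (V *ᵥ c) i ≠ 0 := hi
    positivity
  · obtain ⟨v, hv⟩ := Matrix.vecMul_surjective_iff_isUnit.2 hunit (fun _ => -1)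
    have hv' : ∀ j, ∑ i, v i * Real.exp (P i * x j) = -1 := by
      intro j
      have := congrFun hv j
      simpa [hV, Matrix.vecMul, dotProduct] using this
    have hb : ∀ i, |v i| ≤ C := by
      intro i
      simpa using h 1 v (fun j => by rw [hv' j]; norm_num) i
    have e : (∑ j, c j) = - ∑ i, v i * ∑ j, c j * Real.exp (P i * x j) := by
      simp_rw [Finset.mul_sum]
      rw [Finset.sum_comm, ← Finset.sum_neg_distrib]
      refine Finset.sum_congr rfl fun j _ => ?_
      have : ∑ i, v i * (c j * Real.exp (P i * x j)) = c j * ∑ i, v i * Real.exp (P i * x j) := by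
        rw [Finset.mul_sum]
        exact Finset.sum_congr rfl fun i _ => by ring
      rw [this, hv' j]; ring
    rw [e, neg_sq]
    refine (Finset.sum_mul_sq_le_sq_mul_sq _ _ _).trans ?_
    gcongr
    calc ∑ i, v i ^ 2 ≤ ∑ i : Fin k, C ^ 2 := Finset.sum_le_sum fun i _ => by
          rw [← sq_abs]; have := hb i; gcongr
      _ = k * C ^ 2 := by simp

/-- Fix `0 < a₁ < ⋯ < a_k`.  For all sufficiently small `ε > 0` the function
`f_ε(x) = ∑ₘ exp(aₘ x) + ∑ₘ exp(−aₘ x) − ε` is `k`-positive definite: for all pairwise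
distinct `x₁, …, x_k` the matrix `(f_ε(xᵢ + xⱼ))` is positive definite. -/
theorem f_eps_k_posDef_for_small_eps (k : ℕ) (a : Fin k → ℝ)
    (hpos : ∀ m, 0 < a m) (hmono : StrictMono a) :
    ∃ ε₀ : ℝ, 0 < ε₀ ∧ ∀ ε : ℝ, 0 < ε → ε < ε₀ →
      ∀ x : Fin k → ℝ, Function.Injective x →
        (Matrix.of fun i j : Fin k =>
          (∑ m, Real.exp (a m * (x i + x j)))
            + (∑ m, Real.exp (-(a m) * (x i + x j))) - ε).PosDef := by
  choose C hC h using coeff_bound_fin k a hpos hmono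
  set D : ℝ := ∑ T, k * C T ^ 2 with hD
  have hD0 : 0 ≤ D := Finset.sum_nonneg fun T _ => by positivity
  refine ⟨1 / (1 + D), by positivity, ?_⟩
  intro ε hε hε' x hx
  refine Matrix.PosDef.of_dotProduct_mulVec_pos ?_ ?_
  · ext i j
    simp [add_comm (x i)]
  · intro c hc
    set T : Finset (Fin k) := Finset.univ.filter fun i => x i < 0 with hT
    obtain ⟨q1, q2⟩ := quad_bound k (fun i => if i ∈ T then -a i else a i) x (C T)
      (h T x hx (by simp [hT])) c hc
    set S := ∑ i, (∑ j, c j * Real.exp ((if i ∈ T then -a i else a i) * x j)) ^ 2 with hS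
    have hDT : k * C T ^ 2 ≤ D := Finset.single_le_sum (f := fun T => k * C T ^ 2)
      (fun T _ => by positivity) (Finset.mem_univ T)
    have hsq : ∀ p : ℝ, (∑ j, c j * Real.exp (p * x j)) ^ 2 =
        ∑ i, ∑ j, c i * (c j * Real.exp (p * (x i + x j))) := by
      intro p
      rw [sq, Finset.sum_mul_sum]
      refine Finset.sum_congr rfl fun i _ => Finset.sum_congr rfl fun j _ => ?_
      rw [mul_add, Real.exp_add]; ring
    have hle : S ≤ ∑ m, (∑ j, c j * Real.exp (a m * x j)) ^ 2
        + ∑ m, (∑ j, c j * Real.exp (-(a m) * x j)) ^ 2 := by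
      rw [hS, ← Finset.sum_add_distrib]
      refine Finset.sum_le_sum fun i _ => ?_
      by_cases hi : i ∈ T
      · simp only [hi, if_true]
        linarith [sq_nonneg (∑ j, c j * Real.exp (a i * x j))]
      · simp only [hi, if_false]
        linarith [sq_nonneg (∑ j, c j * Real.exp (-(a i) * x j))]
    have hQ : star c ⬝ᵥ ((Matrix.of fun i j : Fin k =>
          (∑ m, Real.exp (a m * (x i + x j)))
            + (∑ m, Real.exp (-(a m) * (x i + x j))) - ε) *ᵥ c) =
        ∑ m, (∑ j, c j * Real.exp (a m * x j)) ^ 2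
        + ∑ m, (∑ j, c j * Real.exp (-(a m) * x j)) ^ 2 - ε * (∑ j, c j) ^ 2 := by
      simp_rw [hsq]
      have h3 : (∑ j, c j) ^ 2 = ∑ i, ∑ j, c i * c j := by rw [sq, Finset.sum_mul_sum]
      have h4 : ∀ f : Fin k → Fin k → Fin k → ℝ,
          ∑ m, ∑ i, ∑ j, f m i j = ∑ i, ∑ j, ∑ m, f m i j := by
        intro f
        rw [Finset.sum_comm]
        exact Finset.sum_congr rfl fun i _ => Finset.sum_comm
      rw [h3, h4 (fun m i j => c i * (c j * Real.exp (a m * (x i + x j)))),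
        h4 (fun m i j => c i * (c j * Real.exp (-(a m) * (x i + x j)))),
        Finset.mul_sum, ← Finset.sum_add_distrib, ← Finset.sum_sub_distrib]
      simp only [dotProduct, Matrix.mulVec, Matrix.of_apply, Pi.star_apply, star_trivial]
      refine Finset.sum_congr rfl fun i _ => ?_
      rw [Finset.mul_sum, Finset.mul_sum, ← Finset.sum_add_distrib, ← Finset.sum_sub_distrib]
      refine Finset.sum_congr rfl fun j _ => ?_
      simp only [← Finset.mul_sum]
      ring
    rw [hQ]
    have h5 : ε * (1 + D) < 1 := by rwa [lt_div_iff₀ (by positivity)] at hε'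
    have h6 : (∑ j, c j) ^ 2 ≤ D * S := q2.trans (by gcongr)
    have h7 : ε * (∑ j, c j) ^ 2 ≤ ε * (D * S) := by gcongr
    have h8 : ε * (D * S) < S := by nlinarith
    linarith
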